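/- Safety: if ⊢ s : A is a valid typing judgment in the empty context, then either s is normal (there is no t with s → t), or there exists a term t with s → t and ⊢ t : A valid. -/

import Mathlib

/-!
Formalization of the computational algebraic lambda-calculus
(simply-typed, call-by-value lambda-calculus endowed with a structure of
module over a ring `R` of scalars), using de Bruijn indices
(so that α-equivalence is definitional and substitution is capture-avoiding).
-/

namespace AlgLC

/-- Simple types: base types, arrows, products, unit `⊤`, and the monadic type `M A`. -/
inductive Ty (ι : Type) : Type
  | base : ι → Ty ι
  | arrow : Ty ι → Ty ι → Ty ι
  | prod : Ty ι → Ty ι → Ty ι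
  | unit : Ty ι
  | m : Ty ι → Ty ι

/-- Terms (de Bruijn representation): variables, abstraction, application,
pairs `⟨s,t⟩`, projections `π₁ s`, `π₂ s`, the unit `∗`, sums `s+t`,
scalar multiplications `α·s`, the null term `𝟎`, closures `[s]` and
the "run" construct `¡s`. -/
inductive Term (R : Type) : Type
  | var : ℕ → Term R
  | lam : Term R → Term R
  | app : Term R → Term R → Term R
  | pair : Term R → Term R → Term R
  | fst : Term R → Term R
  | snd : Term R → Term R
  | star : Term R
  | add : Term R → Term R → Term R
  | smul : R → Term R → Term R
  | zero : Term R
  | clos : Term R → Term R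
  | unclos : Term R → Term R

variable {R : Type} {ι : Type}

/-- Shift the free de Bruijn indices `≥ k` up by `d`. -/
def lift (d : ℕ) : ℕ → Term R → Term R
  | k, .var n => .var (if n < k then n else n + d)
  | k, .lam t => .lam (lift d (k+1) t)
  | k, .app s t => .app (lift d k s) (lift d k t)
  | k, .pair s t => .pair (lift d k s) (lift d k t)
  | k, .fst s => .fst (lift d k s)
  | k, .snd s => .snd (lift d k s)
  | _, .star => .star
  | k, .add s t => .add (lift d k s) (lift d k t)
  | k, .smul a s => .smul a (lift d k s)
  | _, .zero => .zero
  | k, .clos s => .clos (lift d k s)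
  | k, .unclos s => .unclos (lift d k s)

/-- Capture-avoiding substitution `s[k := v]` of `v` for the de Bruijn index `k`. -/
def subst : Term R → ℕ → Term R → Term R
  | .var n, k, v => if n = k then v else if n < k then .var n else .var (n-1)
  | .lam t, k, v => .lam (subst t (k+1) (lift 1 0 v))
  | .app s t, k, v => .app (subst s k v) (subst t k v)
  | .pair s t, k, v => .pair (subst s k v) (subst t k v)
  | .fst s, k, v => .fst (subst s k v)
  | .snd s, k, v => .snd (subst s k v)
  | .star, _, _ => .star
  | .add s t, k, v => .add (subst s k v) (subst t k v)
  | .smul a s, k, v => .smul a (subst s k v)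
  | .zero, _, _ => .zero
  | .clos s, k, v => .clos (subst s k v)
  | .unclos s, k, v => .unclos (subst s k v)

/-- Values: `u,v ::= x | λx.u | u v | ⟨u,v⟩ | π₁ u | π₂ u | ∗ | [s]`. -/
inductive IsValue : Term R → Prop
  | var {n} : IsValue (.var n)
  | lam {u} : IsValue u → IsValue (.lam u)
  | app {u v} : IsValue u → IsValue v → IsValue (.app u v)
  | pair {u v} : IsValue u → IsValue v → IsValue (.pair u v)
  | fst {u} : IsValue u → IsValue (.fst u)
  | snd {u} : IsValue u → IsValue (.snd u)
  | star : IsValue .star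
  | clos {s} : IsValue (.clos s)

/-- Typing judgments `Δ ⊢ s : A` (the context is a list of types, de Bruijn style). -/
inductive Typed : List (Ty ι) → Term R → Ty ι → Prop
  | var {Γ : List (Ty ι)} {n A} : Γ[n]? = some A → Typed Γ (.var n) A
  | star {Γ} : Typed Γ .star .unit
  | zero {Γ A} : Typed Γ .zero A
  | lam {Γ s A B} : Typed (A :: Γ) s B → Typed Γ (.lam s) (.arrow A B)
  | app {Γ s t A B} : Typed Γ s (.arrow A B) → Typed Γ t A → Typed Γ (.app s t) B
  | pair {Γ s t A B} : Typed Γ s A → Typed Γ t B → Typed Γ (.pair s t) (.prod A B)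
  | fst {Γ s A B} : Typed Γ s (.prod A B) → Typed Γ (.fst s) A
  | snd {Γ s A B} : Typed Γ s (.prod A B) → Typed Γ (.snd s) B
  | smul {Γ s A} (a : R) : Typed Γ s A → Typed Γ (.smul a s) A
  | add {Γ s t A} : Typed Γ s A → Typed Γ t A → Typed Γ (.add s t) A
  | clos {Γ s A} : Typed Γ s A → Typed Γ (.clos s) (.m A)
  | unclos {Γ s A} : Typed Γ s (.m A) → Typed Γ (.unclos s) A

/-- `≃_AC` : the smallest congruent equivalence relation containing
commutativity and associativity of `+`. -/
inductive AC : Term R → Term R → Prop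
  | comm {s t} : AC (.add s t) (.add t s)
  | assoc {r s t} : AC (.add r (.add s t)) (.add (.add r s) t)
  | refl (s) : AC s s
  | symm {s t} : AC s t → AC t s
  | trans {s t u} : AC s t → AC t u → AC s u
  | lam {s s'} : AC s s' → AC (.lam s) (.lam s')
  | appL {s s' t} : AC s s' → AC (.app s t) (.app s' t)
  | appR {s t t'} : AC t t' → AC (.app s t) (.app s t')
  | pairL {s s' t} : AC s s' → AC (.pair s t) (.pair s' t)
  | pairR {s t t'} : AC t t' → AC (.pair s t) (.pair s t')
  | fst {s s'} : AC s s' → AC (.fst s) (.fst s')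
  | snd {s s'} : AC s s' → AC (.snd s) (.snd s')
  | addL {s s' t} : AC s s' → AC (.add s t) (.add s' t)
  | addR {s t t'} : AC t t' → AC (.add s t) (.add s t')
  | smul {a s s'} : AC s s' → AC (.smul a s) (.smul a s')
  | clos {s s'} : AC s s' → AC (.clos s) (.clos s')
  | unclos {s s'} : AC s s' → AC (.unclos s) (.unclos s')

section Rules

variable [Ring R]

/-- The rules of group E. -/
inductive RuleE : Term R → Term R → Prop
  | smul_zero (a : R) : RuleE (.smul a .zero) .zero
  | zero_smul (s : Term R) : RuleE (.smul 0 s) .zero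
  | one_smul (s : Term R) : RuleE (.smul 1 s) s
  | zero_add (s : Term R) : RuleE (.add .zero s) s
  | smul_smul (a b : R) (s : Term R) : RuleE (.smul a (.smul b s)) (.smul (a * b) s)
  | smul_add (a : R) (s t : Term R) :
      RuleE (.smul a (.add s t)) (.add (.smul a s) (.smul a t))

/-- The rules of group F. -/
inductive RuleF : Term R → Term R → Prop
  | add_smul (a b : R) (s : Term R) :
      RuleF (.add (.smul a s) (.smul b s)) (.smul (a + b) s)
  | smul_self (a : R) (s : Term R) : RuleF (.add (.smul a s) s) (.smul (a + 1) s)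
  | self_self (s : Term R) : RuleF (.add s s) (.smul (1 + 1) s)

/-- The rules of group A. -/
inductive RuleA : Term R → Term R → Prop
  | add_app (s t r : Term R) : RuleA (.app (.add s t) r) (.add (.app s r) (.app t r))
  | app_add (r s t : Term R) : RuleA (.app r (.add s t)) (.add (.app r s) (.app r t))
  | smul_app (a : R) (s r : Term R) : RuleA (.app (.smul a s) r) (.smul a (.app s r))
  | app_smul (a : R) (r s : Term R) : RuleA (.app r (.smul a s)) (.smul a (.app r s))
  | zero_app (r : Term R) : RuleA (.app .zero r) .zero
  | app_zero (r : Term R) : RuleA (.app r .zero) .zero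
  | lam_add (s t : Term R) : RuleA (.lam (.add s t)) (.add (.lam s) (.lam t))
  | lam_smul (a : R) (s : Term R) : RuleA (.lam (.smul a s)) (.smul a (.lam s))
  | lam_zero : RuleA (.lam .zero) (.zero : Term R)
  | unclos_add (s t : Term R) : RuleA (.unclos (.add s t)) (.add (.unclos s) (.unclos t))
  | unclos_smul (a : R) (s : Term R) : RuleA (.unclos (.smul a s)) (.smul a (.unclos s))
  | unclos_zero : RuleA (.unclos .zero) (.zero : Term R)

/-- The rules of group B: call-by-value β, running a closure, projections of pairs of values. -/
inductive RuleB : Term R → Term R → Prop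
  | beta {s v : Term R} : IsValue v → RuleB (.app (.lam s) v) (subst s 0 v)
  | run (s : Term R) : RuleB (.unclos (.clos s)) s
  | fst {u v : Term R} : IsValue u → IsValue v → RuleB (.fst (.pair u v)) u
  | snd {u v : Term R} : IsValue u → IsValue v → RuleB (.snd (.pair u v)) v

end Rules

/-- The smallest call-by-value congruent relation (closed under every term
construct except λ-abstraction and closures `[·]`) consistent with `≃_AC`
generated by a set `Rb` of basic rules. -/
inductive Step (Rb : Term R → Term R → Prop) : Term R → Term R → Prop
  | base {s t} : Rb s t → Step Rb s t
  | appL {s s' t} : Step Rb s s' → Step Rb (.app s t) (.app s' t)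
  | appR {s t t'} : Step Rb t t' → Step Rb (.app s t) (.app s t')
  | pairL {s s' t} : Step Rb s s' → Step Rb (.pair s t) (.pair s' t)
  | pairR {s t t'} : Step Rb t t' → Step Rb (.pair s t) (.pair s t')
  | fst {s s'} : Step Rb s s' → Step Rb (.fst s) (.fst s')
  | snd {s s'} : Step Rb s s' → Step Rb (.snd s) (.snd s')
  | addL {s s' t} : Step Rb s s' → Step Rb (.add s t) (.add s' t)
  | addR {s t t'} : Step Rb t t' → Step Rb (.add s t) (.add s t')
  | smul {a s s'} : Step Rb s s' → Step Rb (.smul a s) (.smul a s')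
  | unclos {s s'} : Step Rb s s' → Step Rb (.unclos s) (.unclos s')
  | ac {s s' t t'} : AC s s' → Step Rb s' t' → AC t' t → Step Rb s t

variable [Ring R]

/-- The one-step reduction `→` of the full system `L = E ∪ F ∪ A ∪ B`. -/
def StepL : Term R → Term R → Prop :=
  Step (fun s t => RuleE s t ∨ RuleF s t ∨ RuleA s t ∨ RuleB s t)

/-- The one-step reduction of the purely algebraic system `E ∪ F ∪ A`. -/
def StepEFA : Term R → Term R → Prop :=
  Step (fun s t => RuleE s t ∨ RuleF s t ∨ RuleA s t)

omit [Ring R] in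
theorem Typed.lift_one {Γ : List (Ty ι)} {s : Term R} {A : Ty ι} (h : Typed Γ s A) :
    ∀ {Γ₁ Γ₂ : List (Ty ι)} (B : Ty ι), Γ = Γ₁ ++ Γ₂ →
      Typed (Γ₁ ++ B :: Γ₂) (lift 1 Γ₁.length s) A := by
  induction h with
  | @var Γ n A h =>
    rintro Γ₁ Γ₂ B rfl
    refine Typed.var ?_
    split_ifs with hn
    · rwa [List.getElem?_append_left hn] at h ⊢
    · rw [List.getElem?_append_right (by omega)] at h ⊢
      rwa [Nat.sub_add_comm (by omega), List.getElem?_cons_succ]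
  | star => intros; exact .star
  | zero => intros; exact .zero
  | @lam Γ s A B _ ih =>
    rintro Γ₁ Γ₂ C rfl
    exact .lam (ih (Γ₁ := A :: Γ₁) C rfl)
  | app _ _ ih₁ ih₂ => intro Γ₁ Γ₂ C h; exact .app (ih₁ C h) (ih₂ C h)
  | pair _ _ ih₁ ih₂ => intro Γ₁ Γ₂ C h; exact .pair (ih₁ C h) (ih₂ C h)
  | fst _ ih => intro Γ₁ Γ₂ C h; exact .fst (ih C h)
  | snd _ ih => intro Γ₁ Γ₂ C h; exact .snd (ih C h)
  | smul a _ ih => intro Γ₁ Γ₂ C h; exact .smul a (ih C h)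
  | add _ _ ih₁ ih₂ => intro Γ₁ Γ₂ C h; exact .add (ih₁ C h) (ih₂ C h)
  | clos _ ih => intro Γ₁ Γ₂ C h; exact .clos (ih C h)
  | unclos _ ih => intro Γ₁ Γ₂ C h; exact .unclos (ih C h)

omit [Ring R] in
theorem Typed.subst {Γ : List (Ty ι)} {s : Term R} {A : Ty ι} (h : Typed Γ s A) :
    ∀ {Γ₁ Γ₂ : List (Ty ι)} {B : Ty ι} {v : Term R}, Γ = Γ₁ ++ B :: Γ₂ →
      Typed (Γ₁ ++ Γ₂) v B → Typed (Γ₁ ++ Γ₂) (subst s Γ₁.length v) A := by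
  induction h with
  | @var Γ n A h =>
    rintro Γ₁ Γ₂ B v rfl hv
    unfold AlgLC.subst
    split_ifs with hn hn'
    · subst hn
      simp only [List.getElem?_append_right, le_refl, Nat.sub_self,
        List.getElem?_cons_zero, Option.some.injEq] at h
      exact h ▸ hv
    · refine .var ?_
      rwa [List.getElem?_append_left hn'] at h ⊢
    · refine .var ?_
      rw [List.getElem?_append_right (by omega)] at h ⊢
      rwa [show n - Γ₁.length = n - 1 - Γ₁.length + 1 by omega, List.getElem?_cons_succ] at h
  | star => intros; exact .star
  | zero => intros; exact .zero
  | @lam Γ s A B _ ih =>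
    rintro Γ₁ Γ₂ C v rfl hv
    exact .lam (ih (Γ₁ := A :: Γ₁) rfl (hv.lift_one (Γ₁ := []) A rfl))
  | app _ _ ih₁ ih₂ => intro Γ₁ Γ₂ C v h hv; exact .app (ih₁ h hv) (ih₂ h hv)
  | pair _ _ ih₁ ih₂ => intro Γ₁ Γ₂ C v h hv; exact .pair (ih₁ h hv) (ih₂ h hv)
  | fst _ ih => intro Γ₁ Γ₂ C v h hv; exact .fst (ih h hv)
  | snd _ ih => intro Γ₁ Γ₂ C v h hv; exact .snd (ih h hv)
  | smul a _ ih => intro Γ₁ Γ₂ C v h hv; exact .smul a (ih h hv)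
  | add _ _ ih₁ ih₂ => intro Γ₁ Γ₂ C v h hv; exact .add (ih₁ h hv) (ih₂ h hv)
  | clos _ ih => intro Γ₁ Γ₂ C v h hv; exact .clos (ih h hv)
  | unclos _ ih => intro Γ₁ Γ₂ C v h hv; exact .unclos (ih h hv)

omit [Ring R] in
theorem AC.typed_iff {s t : Term R} (h : AC s t) :
    ∀ (Γ : List (Ty ι)) (A : Ty ι), Typed Γ s A ↔ Typed Γ t A := by
  induction h with
  | comm =>
    intro Γ A
    constructor <;> intro h <;> cases h with | add h₁ h₂ => exact .add h₂ h₁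
  | assoc =>
    intro Γ A
    constructor <;> intro h <;> cases h with | add h h'
    · cases h' with | add h₁ h₂ => exact .add (.add h h₁) h₂
    · cases h with | add h₁ h₂ => exact .add h₁ (.add h₂ h')
  | refl => exact fun _ _ => Iff.rfl
  | symm _ ih => exact fun Γ A => (ih Γ A).symm
  | trans _ _ ih₁ ih₂ => exact fun Γ A => (ih₁ Γ A).trans (ih₂ Γ A)
  | lam _ ih | appL _ ih | appR _ ih | pairL _ ih | pairR _ ih | fst _ ih | snd _ ih | addL _ ih
  | addR _ ih | smul _ ih | clos _ ih | unclos _ ih =>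
    intro Γ A
    constructor <;> intro h <;> cases h <;> constructor <;>
      first | assumption | exact (ih _ _).1 (by assumption) | exact (ih _ _).2 (by assumption)

section Preservation

variable {Γ : List (Ty ι)} {s t : Term R} {A : Ty ι}

theorem RuleE.typed (h : RuleE s t) (hs : Typed Γ s A) : Typed Γ t A := by
  cases h with
  | smul_zero | zero_smul => exact .zero
  | one_smul => cases hs; assumption
  | zero_add => cases hs; assumption
  | smul_smul => cases hs with | smul _ h => cases h with | smul _ h => exact .smul _ h
  | smul_add =>
    cases hs with | smul _ h => cases h with | add h₁ h₂ => exact .add (.smul _ h₁) (.smul _ h₂)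

theorem RuleF.typed (h : RuleF s t) (hs : Typed Γ s A) : Typed Γ t A := by
  cases h with
  | add_smul => cases hs with | add h _ => cases h with | smul _ h => exact .smul _ h
  | smul_self | self_self => cases hs with | add _ h => exact .smul _ h

omit [Ring R] in
theorem RuleA.typed (h : RuleA s t) (hs : Typed Γ s A) : Typed Γ t A := by
  cases h with
  | zero_app | app_zero | lam_zero | unclos_zero => exact .zero
  | add_app =>
    cases hs with | app h h' => cases h with | add h₁ h₂ => exact .add (.app h₁ h') (.app h₂ h')
  | app_add =>
    cases hs with | app h' h => cases h with | add h₁ h₂ => exact .add (.app h' h₁) (.app h' h₂)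
  | smul_app => cases hs with | app h h' => cases h with | smul _ h => exact .smul _ (.app h h')
  | app_smul => cases hs with | app h' h => cases h with | smul _ h => exact .smul _ (.app h' h)
  | lam_add =>
    cases hs with | lam h => cases h with | add h₁ h₂ => exact .add (.lam h₁) (.lam h₂)
  | lam_smul => cases hs with | lam h => cases h with | smul _ h => exact .smul _ (.lam h)
  | unclos_add =>
    cases hs with | unclos h => cases h with | add h₁ h₂ => exact .add (.unclos h₁) (.unclos h₂)
  | unclos_smul => cases hs with | unclos h => cases h with | smul _ h => exact .smul _ (.unclos h)

omit [Ring R] in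
theorem RuleB.typed (h : RuleB s t) (hs : Typed Γ s A) : Typed Γ t A := by
  cases h with
  | beta => cases hs with | app h hv => cases h with | lam h => exact h.subst (Γ₁ := []) rfl hv
  | run => cases hs with | unclos h => cases h with | clos h => exact h
  | fst => cases hs with | fst h => cases h with | pair h _ => exact h
  | snd => cases hs with | snd h => cases h with | pair _ h => exact h

end Preservation

omit [Ring R] in
/-- If the basic rules preserve types, so does the reduction they generate. -/
theorem Step.typed {Rb : Term R → Term R → Prop}
    (hRb : ∀ (Γ : List (Ty ι)) (A : Ty ι) s t, Rb s t → Typed Γ s A → Typed Γ t A)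
    {s t : Term R} (h : Step Rb s t) (Γ : List (Ty ι)) :
    ∀ A : Ty ι, Typed Γ s A → Typed Γ t A := by
  induction h with
  | base h => exact fun A => hRb Γ A _ _ h
  | appL _ ih => intro A h; cases h with | app h h' => exact .app (ih _ h) h'
  | appR _ ih => intro A h; cases h with | app h h' => exact .app h (ih _ h')
  | pairL _ ih => intro A h; cases h with | pair h h' => exact .pair (ih _ h) h'
  | pairR _ ih => intro A h; cases h with | pair h h' => exact .pair h (ih _ h')
  | fst _ ih => intro A h; cases h with | fst h => exact .fst (ih _ h)
  | snd _ ih => intro A h; cases h with | snd h => exact .snd (ih _ h)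
  | addL _ ih => intro A h; cases h with | add h h' => exact .add (ih _ h) h'
  | addR _ ih => intro A h; cases h with | add h h' => exact .add h (ih _ h')
  | smul _ ih => intro A h; cases h with | smul _ h => exact .smul _ (ih _ h)
  | unclos _ ih => intro A h; cases h with | unclos h => exact .unclos (ih _ h)
  | ac h₁ _ h₂ ih => exact fun A h => (h₂.typed_iff Γ A).1 (ih A ((h₁.typed_iff Γ A).1 h))

theorem StepL.typed {s t : Term R} (h : StepL s t) {Γ : List (Ty ι)} {A : Ty ι}
    (hs : Typed Γ s A) : Typed Γ t A := by
  refine Step.typed (fun Γ A s t hr hs => ?_) h Γ A hs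
  rcases hr with h | h | h | h <;> exact h.typed hs

/-- **Safety** : a closed well-typed term is either normal, or makes a step to a
term of the same type. -/
theorem safety {s : Term R} {A : Ty ι} (hs : Typed ([] : List (Ty ι)) s A) :
    (∀ t, ¬ StepL s t) ∨ ∃ t, StepL s t ∧ Typed ([] : List (Ty ι)) t A := by
  by_cases h : ∃ t, StepL s t
  · obtain ⟨t, ht⟩ := h
    exact .inr ⟨t, ht, ht.typed hs⟩
  · exact .inl (not_exists.1 h)

end AlgLC
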